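/- arXiv:1704.00458 — 2 statements merged into one kernel-verified Lean document; each statement's English description precedes it below -/
import Mathlib

section
/- For every C > 0, the quantity q(C) = Σ_{r=1}^{∞} T_r C^{r−1} e^{−Cr}/(r−1)! satisfies 0 < q(C) ≤ 1. -/
/-- `treeTerm C s = T_s C^(s-1) e^(-C s) / (s-1)!` where `T_s = s^(s-2)` is the number of
labelled trees on `s` vertices (with `T_1 = 1`, using truncated subtraction). -/
noncomputable def treeTerm (C : ℝ) (s : ℕ) : ℝ :=
  ((s ^ (s - 2) : ℕ) : ℝ) * C ^ (s - 1) * Real.exp (-C * s) / (Nat.factorial (s - 1))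

/-- `q(C) = ∑_{s=1}^∞ T_s C^(s-1) e^(-C s)/(s-1)!`. -/
noncomputable def qfun (C : ℝ) : ℝ := ∑' r : ℕ, treeTerm C (r + 1)

/-- The sequence `(n + 1)^(n - 1) / n!`, the coefficients of the exponential generating function
of rooted labelled forests. -/
noncomputable def forestCoeff (n : ℕ) : ℝ := ((n : ℝ) + 1) ^ (n - 1) / n.factorial

theorem forestCoeff_pos (n : ℕ) : 0 < forestCoeff n := by
  unfold forestCoeff; positivity

theorem add_one_mul_forestCoeff (n : ℕ) :
    ((n : ℝ) + 1) * forestCoeff n = ((n : ℝ) + 1) ^ n / n.factorial := by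
  unfold forestCoeff
  rcases n with _ | n
  · simp
  · rw [Nat.add_sub_cancel, pow_succ]; ring

theorem sum_neg_one_pow_mul_add_one_pow (n : ℕ) :
    ∑ k ∈ Finset.range (n + 2),
      (-1 : ℝ) ^ (n + 1 - k) * ((n + 1).choose k) * ((k : ℝ) + 1) ^ n = 0 := by
  have h := fwdDiff_iter_eq_sum_shift (1 : ℝ) (fun x : ℝ => x ^ n) (n + 1) 1
  rw [fwdDiff_iter_pow_eq_zero_of_lt (Nat.lt_succ_self n)] at h
  rw [Pi.zero_apply] at h
  rw [h]
  refine Finset.sum_congr rfl fun k _ => ?_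
  simp [add_comm]

/-- **Abel's binomial identity**, divided by `n!`. -/
theorem sum_forestCoeff_mul_sub_pow (n : ℕ) (y : ℝ) :
    ∑ k ∈ Finset.range (n + 1), forestCoeff k * ((y - k) ^ (n - k) / (n - k).factorial) =
      (1 + y) ^ n / n.factorial := by
  induction n generalizing y with
  | zero => simp [forestCoeff]
  | succ n ih =>
    let f : ℝ → ℝ := fun y => ∑ k ∈ Finset.range (n + 2),
      forestCoeff k * ((y - k) ^ (n + 1 - k) / (n + 1 - k).factorial) -
        (1 + y) ^ (n + 1) / (n + 1).factorial
    have pow_deriv (a z : ℝ) (m : ℕ) :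
        HasDerivAt (fun y : ℝ => (y + a) ^ (m + 1) / (m + 1).factorial)
          ((z + a) ^ m / m.factorial) z := by
      have h := (((hasDerivAt_id z).add_const a).pow (m + 1)).div_const ((m + 1).factorial : ℝ)
      refine h.congr_deriv ?_
      rw [Nat.factorial_succ]
      push_cast
      simp only [id, mul_one]
      field_simp
    have hf (z : ℝ) : HasDerivAt f 0 z := by
      have h₁ : HasDerivAt (fun y => ∑ k ∈ Finset.range (n + 2),
          forestCoeff k * ((y - k) ^ (n + 1 - k) / (n + 1 - k).factorial))
          (∑ k ∈ Finset.range (n + 1),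
            forestCoeff k * ((z - k) ^ (n - k) / (n - k).factorial)) z := by
        simp only [Finset.sum_range_succ _ (n + 1), Nat.sub_self, pow_zero]
        refine HasDerivAt.add_const _ (HasDerivAt.fun_sum fun k hk => ?_)
        rw [Nat.succ_sub (Finset.mem_range_succ_iff.1 hk)]
        simpa only [sub_eq_add_neg] using (pow_deriv (-k) z (n - k)).const_mul (forestCoeff k)
      have h₂ := pow_deriv 1 z n
      rw [ih z] at h₁
      simp only [add_comm _ (1 : ℝ)] at h₂
      exact (h₁.sub h₂).congr_deriv (sub_self _)
    have hconst := is_const_of_deriv_eq_zero (fun z => (hf z).differentiableAt)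
      (fun z => (hf z).deriv) y (-1)
    have hneg : f (-1) = 0 := by
      have hs := sum_neg_one_pow_mul_add_one_pow n
      simp only [f]
      rw [add_neg_cancel, zero_pow n.succ_ne_zero, zero_div, sub_zero,
        ← zero_div ((n + 1).factorial : ℝ), ← hs, Finset.sum_div]
      refine Finset.sum_congr rfl fun k hk => ?_
      have hk : k ≤ n + 1 := Finset.mem_range_succ_iff.1 hk
      rw [Nat.cast_choose ℝ hk, show (-1 - k : ℝ) = (-1) * (k + 1) by ring, mul_pow]
      have hpow : ((k : ℝ) + 1) ^ (k - 1) * ((k : ℝ) + 1) ^ (n + 1 - k) = ((k : ℝ) + 1) ^ n ∨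
          k = 0 := by
        rcases k with _ | k
        · exact Or.inr rfl
        · left; rw [← pow_add]; congr 1; omega
      rcases hpow with h | rfl
      · rw [← h, forestCoeff]; field_simp
      · simp [forestCoeff]; field_simp
    rw [hneg] at hconst
    exact sub_eq_zero.1 hconst

theorem sum_forestCoeff_mul_forestCoeff (n : ℕ) :
    ∑ k ∈ Finset.range (n + 1), forestCoeff k * (((n - k : ℕ) + 1) * forestCoeff (n - k)) =
      ((n : ℝ) + 1) * forestCoeff (n + 1) := by
  have h := sum_forestCoeff_mul_sub_pow (n + 1) (n + 1)
  rw [Finset.sum_range_succ] at h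
  have hsum : ∑ k ∈ Finset.range (n + 1), forestCoeff k * (((n - k : ℕ) + 1) * forestCoeff (n - k))
      = ∑ k ∈ Finset.range (n + 1), forestCoeff k *
        (((n : ℝ) + 1 - k) ^ (n + 1 - k) / (n + 1 - k).factorial) := by
    refine Finset.sum_congr rfl fun k hk => ?_
    have hk : k ≤ n := Finset.mem_range_succ_iff.1 hk
    rw [add_one_mul_forestCoeff, Nat.succ_sub hk, Nat.factorial_succ]
    push_cast [Nat.cast_sub hk]
    have : (n : ℝ) - k + 1 ≠ 0 := by
      have : (k : ℝ) ≤ n := by exact_mod_cast hk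
      linarith
    rw [show (n : ℝ) + 1 - k = n - k + 1 by ring, pow_succ]
    field_simp
  rw [hsum, eq_sub_of_add_eq h, forestCoeff, Nat.factorial_succ]
  simp only [Nat.sub_self, pow_zero, Nat.factorial_zero, Nat.add_sub_cancel]
  push_cast
  field_simp
  ring

/-- A partial sum of the generating function of `forestCoeff`. -/
noncomputable def forestSum (N : ℕ) (y : ℝ) : ℝ := ∑ n ∈ Finset.range N, forestCoeff n * y ^ n

theorem hasDerivAt_forestSum_succ (N : ℕ) (y : ℝ) :
    HasDerivAt (forestSum (N + 1))
      (∑ n ∈ Finset.range N, ((n : ℝ) + 1) * forestCoeff (n + 1) * y ^ n) y := by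
  have h : HasDerivAt (fun y => ∑ n ∈ Finset.range N, forestCoeff (n + 1) * y ^ (n + 1) +
      forestCoeff 0 * y ^ 0)
      (∑ n ∈ Finset.range N, ((n : ℝ) + 1) * forestCoeff (n + 1) * y ^ n) y := by
    simp only [pow_zero]
    refine HasDerivAt.add_const _ (HasDerivAt.fun_sum fun n _ => ?_)
    refine ((hasDerivAt_pow (n + 1) y).const_mul (forestCoeff (n + 1))).congr_deriv ?_
    push_cast [Nat.add_sub_cancel]
    ring
  refine h.congr_of_eventuallyEq (Filter.Eventually.of_forall fun z => ?_)
  exact Finset.sum_range_succ' _ _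

theorem hasDerivAt_mul_forestSum (N : ℕ) (y : ℝ) :
    HasDerivAt (fun z => z * forestSum N z)
      (∑ n ∈ Finset.range N, ((n : ℝ) + 1) * forestCoeff n * y ^ n) y := by
  have h : HasDerivAt (fun y => ∑ n ∈ Finset.range N, forestCoeff n * y ^ (n + 1))
      (∑ n ∈ Finset.range N, ((n : ℝ) + 1) * forestCoeff n * y ^ n) y := by
    refine HasDerivAt.fun_sum fun n _ => ?_
    refine ((hasDerivAt_pow (n + 1) y).const_mul (forestCoeff n)).congr_deriv ?_
    push_cast [Nat.add_sub_cancel]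
    ring
  refine h.congr_of_eventuallyEq (Filter.Eventually.of_forall fun z => ?_)
  simp only [forestSum, Finset.mul_sum]
  exact Finset.sum_congr rfl fun n _ => by ring

theorem deriv_forestSum_succ_le (N : ℕ) {y : ℝ} (hy : 0 ≤ y) :
    ∑ n ∈ Finset.range N, ((n : ℝ) + 1) * forestCoeff (n + 1) * y ^ n ≤
      forestSum (N + 1) y * ∑ n ∈ Finset.range N, ((n : ℝ) + 1) * forestCoeff n * y ^ n := by
  have hpos (n : ℕ) : 0 ≤ forestCoeff n * y ^ n :=
    mul_nonneg (forestCoeff_pos n).le (pow_nonneg hy n)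
  have hpos' (n : ℕ) : 0 ≤ ((n : ℝ) + 1) * forestCoeff n * y ^ n := by
    rw [mul_assoc]; exact mul_nonneg (by positivity) (hpos n)
  calc ∑ n ∈ Finset.range N, ((n : ℝ) + 1) * forestCoeff (n + 1) * y ^ n
      = ∑ n ∈ Finset.range N, ∑ k ∈ Finset.range (n + 1),
          forestCoeff k * y ^ k * (((n - k : ℕ) + 1) * forestCoeff (n - k) * y ^ (n - k)) := by
        refine Finset.sum_congr rfl fun n _ => ?_
        rw [← sum_forestCoeff_mul_forestCoeff, Finset.sum_mul]
        refine Finset.sum_congr rfl fun k hk => ?_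
        rw [← pow_mul_pow_sub y (Finset.mem_range_succ_iff.1 hk)]
        ring
    _ = ∑ k ∈ Finset.range N, ∑ j ∈ Finset.range (N - k),
          forestCoeff k * y ^ k * (((j : ℕ) + 1) * forestCoeff j * y ^ j) :=
        Finset.sum_range_diag_flip N fun k j =>
          forestCoeff k * y ^ k * (((j : ℕ) + 1) * forestCoeff j * y ^ j)
    _ ≤ ∑ k ∈ Finset.range (N + 1), ∑ j ∈ Finset.range N,
          forestCoeff k * y ^ k * (((j : ℕ) + 1) * forestCoeff j * y ^ j) := by
        refine (Finset.sum_le_sum fun k _ => ?_).trans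
          (Finset.sum_le_sum_of_subset_of_nonneg (Finset.range_subset_range.2 N.le_succ)
            fun k _ _ => Finset.sum_nonneg fun j _ => mul_nonneg (hpos k) (hpos' j))
        exact Finset.sum_le_sum_of_subset_of_nonneg (Finset.range_subset_range.2 (N.sub_le k))
          fun j _ _ => mul_nonneg (hpos k) (hpos' j)
    _ = _ := by rw [forestSum, Finset.sum_mul_sum]

theorem forestSum_succ_le_exp (N : ℕ) {y : ℝ} (hy : 0 ≤ y) :
    forestSum (N + 1) y ≤ Real.exp (y * forestSum N y) := by
  have hd (z : ℝ) := (hasDerivAt_forestSum_succ N z).mul (hasDerivAt_mul_forestSum N z).neg.exp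
  have hanti : AntitoneOn (forestSum (N + 1) * fun z => Real.exp (-(z * forestSum N z)))
      (Set.Ici 0) := by
    refine antitoneOn_of_deriv_nonpos (convex_Ici 0)
      (fun z _ => (hd z).continuousAt.continuousWithinAt)
      (fun z _ => (hd z).differentiableAt.differentiableWithinAt) fun z hz => ?_
    rw [interior_Ici, Set.mem_Ioi] at hz
    refine (hd z).deriv.trans_le ?_
    have h := mul_le_mul_of_nonneg_right (deriv_forestSum_succ_le N hz.le)
      (Real.exp_pos (-(z * forestSum N z))).le
    simp only [Pi.neg_apply]
    linarith
  have h := hanti Set.self_mem_Ici hy hy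
  have h0 : forestSum (N + 1) 0 = 1 := by
    simp [forestSum, Finset.sum_range_succ', forestCoeff]
  simp only [Pi.mul_apply, h0, zero_mul, Real.exp_neg, Real.exp_zero, inv_one, mul_one] at h
  rwa [← div_eq_mul_inv, div_le_one (Real.exp_pos _)] at h

theorem forestSum_mul_exp_neg_le {C : ℝ} (hC : 0 ≤ C) (N : ℕ) :
    forestSum N (C * Real.exp (-C)) ≤ Real.exp C := by
  induction N with
  | zero => simpa [forestSum] using (Real.exp_pos C).le
  | succ N ih =>
    refine (forestSum_succ_le_exp N (by positivity)).trans (Real.exp_le_exp.2 ?_)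
    calc C * Real.exp (-C) * forestSum N (C * Real.exp (-C))
        ≤ C * Real.exp (-C) * Real.exp C := by gcongr
      _ = C := by rw [mul_assoc, ← Real.exp_add, neg_add_cancel, Real.exp_zero, mul_one]

theorem treeTerm_succ (C : ℝ) (r : ℕ) :
    treeTerm C (r + 1) = Real.exp (-C) * (forestCoeff r * (C * Real.exp (-C)) ^ r) := by
  have hexp : Real.exp (-C * (r + 1 : ℕ)) = Real.exp (-C) * Real.exp (-C) ^ r := by
    rw [← Real.exp_nat_mul, ← Real.exp_add]
    push_cast
    ring_nf
  rw [treeTerm, forestCoeff, hexp, mul_pow, Nat.add_sub_cancel, show r + 1 - 2 = r - 1 by omega]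
  push_cast
  ring

/-- For every `C > 0` we have `0 < q(C) ≤ 1`. -/
theorem qfun_pos_le_one (C : ℝ) (hC : 0 < C) : 0 < qfun C ∧ qfun C ≤ 1 := by
  have hpos (r : ℕ) : 0 < treeTerm C (r + 1) := by
    have := forestCoeff_pos r
    rw [treeTerm_succ]
    positivity
  have hle (N : ℕ) : ∑ r ∈ Finset.range N, treeTerm C (r + 1) ≤ 1 := by
    simp only [treeTerm_succ]
    rw [← Finset.mul_sum, Real.exp_neg, inv_mul_le_one₀ (Real.exp_pos C), ← Real.exp_neg]
    exact forestSum_mul_exp_neg_le hC.le N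
  have hsum := summable_of_sum_range_le (fun r => (hpos r).le) hle
  exact ⟨hsum.tsum_pos (fun r => (hpos r).le) 0 (hpos 0),
    Real.tsum_le_of_sum_range_le (fun r => (hpos r).le) hle⟩
end

section
/- The function q(C) = Σ_{r=1}^{∞} T_r C^{r−1} e^{−Cr}/(r−1)! is strictly decreasing on (1, ∞), and for every C > 1 it satisfies 0 < q(C) < 1. -/
/-- `∑_{r ≤ n} a (a + r)^(r-1) e^(-r) / r!`, a truncation of the Abel series of `e^a`. -/
noncomputable def abelSum (n : ℕ) (a : ℝ) : ℝ :=
  1 + ∑ k ∈ Finset.range n,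
    a * (a + (k + 1)) ^ k * (Real.exp (-(k + 1)) / (Nat.factorial (k + 1)))

lemma hasDerivAt_abel_monomial (k : ℕ) (a : ℝ) :
    HasDerivAt (fun a : ℝ => a * (a + ((k + 1 : ℕ) + 1)) ^ (k + 1))
      ((k + 2) * ((a + 1) * (a + 1 + (k + 1)) ^ k)) a := by
  have h := (hasDerivAt_id a).mul
    (((hasDerivAt_id a).add_const (((k + 1 : ℕ) : ℝ) + 1)).pow (k + 1))
  refine h.congr_deriv ?_
  simp only [id, Nat.add_sub_cancel, Pi.pow_apply]
  push_cast
  ring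

lemma hasDerivAt_abelSum (n : ℕ) (a : ℝ) :
    HasDerivAt (abelSum (n + 1)) (Real.exp (-1) * abelSum n (a + 1)) a := by
  have h : HasDerivAt (fun a : ℝ => 1 + (∑ k ∈ Finset.range n,
        a * (a + ((k + 1 : ℕ) + 1)) ^ (k + 1) *
          (Real.exp (-((k + 1 : ℕ) + 1)) / (Nat.factorial (k + 1 + 1))) + a * Real.exp (-1)))
      (∑ k ∈ Finset.range n, ((k + 2) * ((a + 1) * (a + 1 + (k + 1)) ^ k)) *
          (Real.exp (-((k + 1 : ℕ) + 1)) / (Nat.factorial (k + 1 + 1))) + 1 * Real.exp (-1)) a :=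
    ((HasDerivAt.fun_sum fun k _ => (hasDerivAt_abel_monomial k a).mul_const _).add
      ((hasDerivAt_id a).mul_const _)).const_add 1
  have hfun : abelSum (n + 1) = fun a : ℝ => 1 + (∑ k ∈ Finset.range n,
        a * (a + ((k + 1 : ℕ) + 1)) ^ (k + 1) *
          (Real.exp (-((k + 1 : ℕ) + 1)) / (Nat.factorial (k + 1 + 1))) + a * Real.exp (-1)) := by
    funext b
    rw [abelSum, Finset.sum_range_succ']
    simp
  rw [hfun]
  refine h.congr_deriv ?_
  rw [abelSum, mul_add, Finset.mul_sum, add_comm, one_mul, mul_one]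
  congr 1
  refine Finset.sum_congr rfl fun k _ => ?_
  have he : Real.exp (-(((k + 1 : ℕ) : ℝ) + 1)) = Real.exp (-1) * Real.exp (-(k + 1)) := by
    rw [← Real.exp_add]
    push_cast
    ring_nf
  rw [he, Nat.factorial_succ (k + 1)]
  push_cast
  have hk : (k : ℝ) + 1 + 1 ≠ 0 := by positivity
  field_simp
  ring

lemma abelSum_le_exp (n : ℕ) {a : ℝ} (ha : 0 ≤ a) : abelSum n a ≤ Real.exp a := by
  induction n generalizing a with
  | zero => simpa [abelSum] using ha
  | succ n ih =>
    have hd (x : ℝ) : HasDerivAt (fun x => Real.exp x - abelSum (n + 1) x)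
        (Real.exp x - Real.exp (-1) * abelSum n (x + 1)) x :=
      (Real.hasDerivAt_exp x).sub (hasDerivAt_abelSum n x)
    have hmono : MonotoneOn (fun x => Real.exp x - abelSum (n + 1) x) (Set.Ici 0) := by
      refine monotoneOn_of_deriv_nonneg (convex_Ici 0)
        (fun x _ => (hd x).continuousAt.continuousWithinAt)
        (fun x _ => (hd x).differentiableAt.differentiableWithinAt) fun x hx => ?_
      rw [interior_Ici] at hx
      have hx' : (0 : ℝ) ≤ x + 1 := by linarith [Set.mem_Ioi.mp hx]
      have := mul_le_mul_of_nonneg_left (ih hx') (Real.exp_pos (-1)).le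
      rw [← Real.exp_add, neg_add_cancel_comm_assoc] at this
      rw [(hd x).deriv]
      linarith
    have := hmono Set.self_mem_Ici (Set.mem_Ici.mpr ha) ha
    simp only [abelSum, Real.exp_zero, zero_mul, Finset.sum_const_zero] at this ⊢
    linarith

lemma treeTerm_pos {C : ℝ} (hC : 0 < C) (r : ℕ) : 0 < treeTerm C (r + 1) := by
  unfold treeTerm
  positivity

lemma sum_treeTerm_one (n : ℕ) :
    ∑ r ∈ Finset.range (n + 1), treeTerm 1 (r + 1) = Real.exp (-1) * abelSum n 1 := by
  rw [Finset.sum_range_succ', abelSum, mul_add, Finset.mul_sum, add_comm]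
  congr 1
  · simp [treeTerm]
  · refine Finset.sum_congr rfl fun k _ => ?_
    have he : Real.exp (-1 * ((k + 1 + 1 : ℕ) : ℝ)) = Real.exp (-1) * Real.exp (-(k + 1)) := by
      rw [← Real.exp_add]
      push_cast
      ring_nf
    rw [treeTerm, he]
    simp only [Nat.add_sub_cancel, Nat.reduceSubDiff, one_pow]
    push_cast
    ring

lemma sum_treeTerm_one_le (n : ℕ) : ∑ r ∈ Finset.range n, treeTerm 1 (r + 1) ≤ 1 := by
  calc ∑ r ∈ Finset.range n, treeTerm 1 (r + 1)
      ≤ ∑ r ∈ Finset.range (n + 1), treeTerm 1 (r + 1) := by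
        rw [Finset.sum_range_succ]
        linarith [treeTerm_pos one_pos n]
    _ = Real.exp (-1) * abelSum n 1 := sum_treeTerm_one n
    _ ≤ Real.exp (-1) * Real.exp 1 := by
        gcongr
        exact abelSum_le_exp n zero_le_one
    _ = 1 := by rw [← Real.exp_add]; simp

lemma summable_treeTerm_one : Summable fun r : ℕ => treeTerm 1 (r + 1) :=
  summable_of_sum_range_le (fun r => (treeTerm_pos one_pos r).le) sum_treeTerm_one_le

lemma qfun_one_le : qfun 1 ≤ 1 :=
  Real.tsum_le_of_sum_range_le (fun r => (treeTerm_pos one_pos r).le) sum_treeTerm_one_le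

lemma treeTerm_lt_treeTerm {C D : ℝ} (hC : 1 ≤ C) (hCD : C < D) (r : ℕ) :
    treeTerm D (r + 1) < treeTerm C (r + 1) := by
  have hC0 : 0 < C := by linarith
  have hD : D ≤ C * Real.exp (D - C) := by
    nlinarith [Real.add_one_le_exp (D - C)]
  have key : D ^ r * Real.exp (-D * (r + 1 : ℕ)) < C ^ r * Real.exp (-C * (r + 1 : ℕ)) := by
    calc D ^ r * Real.exp (-D * (r + 1 : ℕ))
        ≤ (C * Real.exp (D - C)) ^ r * Real.exp (-D * (r + 1 : ℕ)) := by
          gcongr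
          linarith
      _ = C ^ r * Real.exp (r * (D - C) + -D * (r + 1 : ℕ)) := by
          rw [mul_pow, ← Real.exp_nat_mul, mul_assoc, ← Real.exp_add]
      _ < C ^ r * Real.exp (-C * (r + 1 : ℕ)) := by
          gcongr
          push_cast
          linarith
  have hT : (0 : ℝ) < (((r + 1) ^ (r + 1 - 2) : ℕ) : ℝ) := by positivity
  simp only [treeTerm, Nat.add_sub_cancel, mul_assoc]
  gcongr

lemma summable_treeTerm {C : ℝ} (hC : 1 ≤ C) : Summable fun r : ℕ => treeTerm C (r + 1) := by
  rcases hC.eq_or_lt with rfl | h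
  · exact summable_treeTerm_one
  · exact summable_treeTerm_one.of_nonneg_of_le
      (fun r => (treeTerm_pos (one_pos.trans h) r).le)
      fun r => (treeTerm_lt_treeTerm le_rfl h r).le

lemma qfun_strictAntiOn_Ici : StrictAntiOn qfun (Set.Ici (1 : ℝ)) := fun _ hC _ hD hCD =>
  (summable_treeTerm hD).tsum_lt_tsum (i := 0) (fun r => (treeTerm_lt_treeTerm hC hCD r).le)
    (treeTerm_lt_treeTerm hC hCD 0) (summable_treeTerm hC)

/-- The function `q` is strictly decreasing on `(1, ∞)`, and `0 < q(C) < 1` for `C > 1`. -/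
theorem qfun_strictAntiOn_and_lt_one :
    StrictAntiOn qfun (Set.Ioi (1 : ℝ)) ∧
      ∀ C : ℝ, 1 < C → 0 < qfun C ∧ qfun C < 1 := by
  refine ⟨qfun_strictAntiOn_Ici.mono Set.Ioi_subset_Ici_self, fun C hC => ⟨?_, ?_⟩⟩
  · have hpos := treeTerm_pos (one_pos.trans hC)
    exact (summable_treeTerm hC.le).tsum_pos (fun r => (hpos r).le) 0 (hpos 0)
  · exact (qfun_strictAntiOn_Ici Set.self_mem_Ici hC.le hC).trans_le qfun_one_le
end
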